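/- arXiv:1806.09767 — 2 statements merged into one kernel-verified Lean document; each statement's English description precedes it below -/
import Mathlib

section
/- For every nonnegative integer N and complex numbers t, \(\alpha\), \(\beta\) (avoiding poles), we have \(\Gamma(\alpha+N)\sum_{i=0}^{N}(-1)^i\binom{N}{i}\frac{\Gamma(t+i)}{\Gamma(\alpha+i)}\cdot\frac{\Gamma(t+\beta+\alpha+N-1+i)}{\Gamma(2t+\beta+i)} = (-1)^N\frac{\Gamma(t)\Gamma(t+\beta+\alpha+N-1)}{\Gamma(2t+\beta+N)}\cdot\frac{\Gamma(t+\beta+N)}{\Gamma(t+\beta)}\cdot\frac{\Gamma(t-\alpha+1)}{\Gamma(t-\alpha-N+1)}\). -/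
open Complex Finset

/-- Rising factorial. -/
def rf (x : ℂ) (n : ℕ) : ℂ := ∏ k ∈ Finset.range n, (x + k)

lemma rf_zero (x : ℂ) : rf x 0 = 1 := by simp [rf]

lemma rf_succ (x : ℂ) (n : ℕ) : rf x (n + 1) = rf x n * (x + n) := by
  simp [rf, Finset.prod_range_succ]

lemma rf_succ' (x : ℂ) (n : ℕ) : rf x (n + 1) = x * rf (x + 1) n := by
  rw [rf, Finset.prod_range_succ', rf, mul_comm]
  simp only [Nat.cast_zero, add_zero]
  congr 1
  apply Finset.prod_congr rfl
  intro k _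
  push_cast
  ring

lemma rf_shift (x : ℂ) (n : ℕ) : (x + n) * rf x n = x * rf (x + 1) n := by
  rw [← rf_succ', rf_succ, mul_comm]

lemma rf_cont (n : ℕ) : Continuous fun x : ℂ => rf x n := by
  unfold rf
  fun_prop

lemma rf_reflect (x : ℂ) (n : ℕ) : (-1 : ℂ) ^ n * rf (x - n + 1) n = rf (-x) n := by
  induction n with
  | zero => simp [rf_zero]
  | succ n ih =>
    rw [rf_succ (-x), ← ih, rf_succ']
    have : x - ((n + 1 : ℕ) : ℂ) + 1 + 1 = x - n + 1 := by push_cast; ring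
    rw [this]
    push_cast
    ring

lemma gamma_rf (x : ℂ) (n : ℕ) (hx : ∀ m : ℕ, x ≠ -m) :
    Complex.Gamma (x + n) = rf x n * Complex.Gamma x := by
  induction n with
  | zero => simp [rf_zero]
  | succ n ih =>
    have h : x + n ≠ 0 := fun h => hx n (eq_neg_of_add_eq_zero_left h)
    have : x + ((n + 1 : ℕ) : ℂ) = (x + n) + 1 := by push_cast; ring
    rw [this, Complex.Gamma_add_one _ h, ih, rf_succ]
    ring

/-- The polynomial form of the sum. -/
def saalS (N : ℕ) (t b a : ℂ) : ℂ :=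
  ∑ i ∈ Finset.range (N + 1), (N.choose i : ℂ) *
    ((-1) ^ i * rf t i * rf (b + a + N - 1) i * rf (a + i) (N - i) * rf (t + b + i) (N - i))

lemma saalS_cont (N : ℕ) (t a : ℂ) : Continuous fun b => saalS N t b a := by
  unfold saalS
  have := rf_cont
  refine continuous_finsetSum _ fun i _ => ?_
  have h1 : Continuous fun b => rf (b + a + N - 1) i := (rf_cont i).comp (by fun_prop)
  have h2 : Continuous fun b => rf (t + b + i) (N - i) := (rf_cont _).comp (by fun_prop)
  fun_prop

lemma saalS_succ (N : ℕ) (t b a : ℂ) :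
    (b + a + N - t) * saalS (N + 1) t b a =
      b * (a - t) * (b + a + N) * saalS N t (b + 1) (a + 1)
      - (N * (b + a + N - t) + b * (a - t)) * t * saalS N (t + 1) b (a + 1) := by
  have h := Finset.sum_choose_succ_mul (R := ℂ) (fun i j =>
    (-1) ^ i * rf t i * rf (b + a + N) i * rf (a + i) j * rf (t + b + i) j) N
  have h0 := h
  rw [← Finset.sum_add_distrib] at h0
  have hd : saalS (N + 1) t b a = ∑ i ∈ Finset.range (N + 2), ((N + 1).choose i : ℂ) *
      ((-1) ^ i * rf t i * rf (b + a + N) i * rf (a + i) (N + 1 - i) *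
        rf (t + b + i) (N + 1 - i)) := by
    unfold saalS
    have : b + a + ((N + 1 : ℕ) : ℂ) - 1 = b + a + N := by push_cast; ring
    rw [this]
  rw [hd, h0]
  unfold saalS
  rw [Finset.mul_sum, Finset.mul_sum, Finset.mul_sum, ← Finset.sum_sub_distrib]
  apply Finset.sum_congr rfl
  intro i hi
  have hi' : i ≤ N := Nat.lt_succ_iff.mp (Finset.mem_range.mp hi)
  have e : N + 1 - i = (N - i) + 1 := by omega
  have e1 : b + 1 + (a + 1) + (N : ℂ) - 1 = b + a + N + 1 := by ring
  have e2 : b + (a + 1) + (N : ℂ) - 1 = b + a + N := by ring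
  have e3 : a + 1 + (i : ℂ) = a + i + 1 := by ring
  have e4 : t + (b + 1) + (i : ℂ) = t + b + i + 1 := by ring
  have e5 : t + 1 + b + (i : ℂ) = t + b + i + 1 := by ring
  have e6 : a + ((i + 1 : ℕ) : ℂ) = a + i + 1 := by push_cast; ring
  have e7 : t + b + ((i + 1 : ℕ) : ℂ) = t + b + i + 1 := by push_cast; ring
  rw [e, e1, e2, e3, e4, e5, e6, e7, rf_succ' (a + i), rf_succ' (t + b + i), rf_succ t, rf_succ]
  have k1 := rf_shift t i
  have k2 := rf_shift (b + a + N) i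
  generalize rf (a + i + 1) (N - i) = X
  generalize rf (t + b + i + 1) (N - i) = Y
  linear_combination (N.choose i : ℂ) * (-1) ^ i * X * Y * (b * (a - t) * rf t i * k2
    - (N * (b + a + N - t) + b * (a - t)) * rf (b + a + N) i * k1)

lemma saalS_eq (N : ℕ) : ∀ t b a : ℂ, saalS N t b a = rf b N * rf (a - t) N := by
  induction N with
  | zero => intro t b a; simp [saalS, rf_zero]
  | succ N ih =>
    intro t b a
    have hc : Continuous fun b => rf b (N + 1) * rf (a - t) (N + 1) :=
      (rf_cont _).mul continuous_const
    refine congrFun (Continuous.ext_on (dense_compl_singleton (t - a - N))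
      (saalS_cont (N + 1) t a) hc ?_) b
    intro b hb
    have hD : b + a + N - t ≠ 0 := by
      intro h
      apply hb
      simp only [Set.mem_singleton_iff]
      linear_combination h
    apply mul_left_cancel₀ hD
    simp only
    rw [saalS_succ, ih, ih]
    have e1 : a + 1 - t = a - t + 1 := by ring
    have e2 : a + 1 - (t + 1) = a - t := by ring
    rw [e1, e2, rf_succ, rf_succ]
    have k1 := rf_shift b N
    have k2 := rf_shift (a - t) N
    linear_combination (-(b + a + N)) * ((a - t) * rf (a - t + 1) N * k1
      + (b + N) * rf b N * k2)

/-- Orloff's combinatorial Gamma identity. -/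
theorem stmt1 (N : ℕ) (t α β : ℂ)
    (ht : ∀ n : ℕ, t ≠ -n) (hα : ∀ n : ℕ, α ≠ -n)
    (htβ : ∀ n : ℕ, t + β ≠ -n) (h2tβ : ∀ n : ℕ, 2 * t + β ≠ -n)
    (hbig : ∀ n : ℕ, t + β + α + N - 1 ≠ -n)
    (htα : ∀ n : ℕ, t - α + 1 ≠ -n) (htαN : ∀ n : ℕ, t - α - N + 1 ≠ -n) :
    Complex.Gamma (α + N) *
        ∑ i ∈ Finset.range (N + 1),
          (-1 : ℂ) ^ i * (N.choose i : ℂ) *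
            (Complex.Gamma (t + i) / Complex.Gamma (α + i)) *
            (Complex.Gamma (t + β + α + N - 1 + i) / Complex.Gamma (2 * t + β + i))
      = (-1 : ℂ) ^ N *
          (Complex.Gamma t * Complex.Gamma (t + β + α + N - 1) /
            Complex.Gamma (2 * t + β + N)) *
          (Complex.Gamma (t + β + N) / Complex.Gamma (t + β)) *
          (Complex.Gamma (t - α + 1) / Complex.Gamma (t - α - N + 1)) := by
  have gs : ∀ (x : ℂ), (∀ n : ℕ, x ≠ -n) → ∀ i ≤ N,
      Complex.Gamma (x + N) = rf (x + i) (N - i) * Complex.Gamma (x + i) ∧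
      Complex.Gamma (x + i) ≠ 0 := by
    intro x hx i hi
    have hxi : ∀ m : ℕ, x + i ≠ -m := by
      intro m h
      apply hx (m + i)
      push_cast
      linear_combination h
    refine ⟨?_, Complex.Gamma_ne_zero hxi⟩
    rw [← gamma_rf _ _ hxi, Nat.cast_sub hi]
    congr 1
    ring
  have hS := saalS_eq N t (t + β) α
  have hc := (gs _ h2tβ N le_rfl).2
  have hb := Complex.Gamma_ne_zero htβ
  have ha := Complex.Gamma_ne_zero htαN
  have hr := rf_reflect (t - α) N
  have g1 := gamma_rf _ N htαN
  have g2 := gamma_rf _ N htβ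
  rw [show t - α - N + 1 + (N : ℂ) = t - α + 1 by ring] at g1
  rw [show -(t - α) = α - t by ring] at hr
  rw [g1, g2, mul_div_cancel_right₀ _ hb, mul_div_cancel_right₀ _ ha]
  have hL : Complex.Gamma (α + N) *
        ∑ i ∈ Finset.range (N + 1),
          (-1 : ℂ) ^ i * (N.choose i : ℂ) *
            (Complex.Gamma (t + i) / Complex.Gamma (α + i)) *
            (Complex.Gamma (t + β + α + N - 1 + i) / Complex.Gamma (2 * t + β + i))
      = Complex.Gamma t * Complex.Gamma (t + β + α + N - 1) /
            Complex.Gamma (2 * t + β + N) * saalS N t (t + β) α := by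
    unfold saalS
    rw [Finset.mul_sum, Finset.mul_sum]
    apply Finset.sum_congr rfl
    intro i hi
    have hi' : i ≤ N := Nat.lt_succ_iff.mp (Finset.mem_range.mp hi)
    obtain ⟨a1, a2⟩ := gs _ hα i hi'
    obtain ⟨c1, c2⟩ := gs _ h2tβ i hi'
    rw [gamma_rf t i ht, gamma_rf _ i hbig, a1,
      show t + (t + β) + (i : ℂ) = 2 * t + β + i by ring]
    rw [div_mul_eq_mul_div, eq_div_iff hc, c1]
    generalize Complex.Gamma (2 * t + β + i) = G at *
    field_simp
  rw [hL, hS, ← hr]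
  ring
end

section
/- For complex numbers \(\alpha, \beta\) with \(\mathrm{Re}(\alpha+\beta) > 1\), we have \(\int_{-\infty}^{\infty} \frac{dx}{(1+ix)^{\alpha}(1-ix)^{\beta}} = 2^{2-\alpha-\beta}\pi\frac{\Gamma(\alpha+\beta-1)}{\Gamma(\alpha)\Gamma(\beta)}\). -/
open Complex MeasureTheory

open Set Filter Topology FourierTransform

/-- the integrand -/
noncomputable def cauE (a b : ℂ) (x : ℝ) : ℂ :=
  (1 + (x : ℂ) * Complex.I) ^ (-a) * (1 - (x : ℂ) * Complex.I) ^ (-b)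

lemma cau_slit_p (x : ℝ) : (1 + (x : ℂ) * Complex.I) ∈ slitPlane := by
  left; simp

lemma cau_slit_m (x : ℝ) : (1 - (x : ℂ) * Complex.I) ∈ slitPlane := by
  left; simp

lemma cau_ne_p (x : ℝ) : (1 + (x : ℂ) * Complex.I) ≠ 0 := slitPlane_ne_zero (cau_slit_p x)
lemma cau_ne_m (x : ℝ) : (1 - (x : ℂ) * Complex.I) ≠ 0 := slitPlane_ne_zero (cau_slit_m x)

lemma cau_norm_cpow_le (z w : ℂ) : ‖z ^ w‖ ≤ Real.exp (Real.pi * |w.im|) * ‖z‖ ^ w.re := by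
  refine (norm_cpow_le z w).trans ?_
  rw [div_eq_mul_inv, ← Real.exp_neg, mul_comm]
  gcongr
  calc -(arg z * w.im) ≤ |arg z * w.im| := neg_le_abs _
    _ = |arg z| * |w.im| := abs_mul _ _
    _ ≤ Real.pi * |w.im| := by gcongr; exact abs_arg_le_pi z

lemma cau_norm_p (x : ℝ) : ‖1 + (x : ℂ) * Complex.I‖ = (1 + ‖x‖ ^ 2) ^ ((1 : ℝ) / 2) := by
  have := Complex.norm_add_mul_I 1 x
  rw [ofReal_one] at this
  rw [this, Real.sqrt_eq_rpow]; simp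

lemma cau_norm_m (x : ℝ) : ‖1 - (x : ℂ) * Complex.I‖ = (1 + ‖x‖ ^ 2) ^ ((1 : ℝ) / 2) := by
  have := cau_norm_p (-x)
  simpa [sub_eq_add_neg] using this

lemma cau_bound (a b : ℂ) (x : ℝ) : ‖cauE a b x‖ ≤
    (Real.exp (Real.pi * |a.im|) * Real.exp (Real.pi * |b.im|)) *
      (1 + ‖x‖ ^ 2) ^ (-(a + b).re / 2) := by
  have h0 : 0 < 1 + ‖x‖ ^ 2 := by positivity
  rw [cauE, norm_mul]
  have h1 := cau_norm_cpow_le (1 + (x : ℂ) * Complex.I) (-a)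
  have h2 := cau_norm_cpow_le (1 - (x : ℂ) * Complex.I) (-b)
  rw [cau_norm_p, ← Real.rpow_mul h0.le] at h1
  rw [cau_norm_m, ← Real.rpow_mul h0.le] at h2
  refine (mul_le_mul h1 h2 (norm_nonneg _) (by positivity)).trans (le_of_eq ?_)
  rw [mul_mul_mul_comm, ← Real.rpow_add h0]
  simp only [neg_im, abs_neg, neg_re, add_re]
  congr 2
  ring

lemma cau_cpow_comp {f : ℝ → ℂ} {f' : ℂ} {x : ℝ} (h : HasDerivAt f f' x) (hz : f x ∈ slitPlane)
    (a : ℂ) : HasDerivAt (fun x : ℝ => f x ^ a) (a * f x ^ (a - 1) * f') x := by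
  have h1 : HasDerivAt (fun z : ℂ => z ^ a) (a * f x ^ (a - 1)) (f x) := by
    simpa using (hasDerivAt_id (f x)).cpow_const (c := a) hz
  exact h1.comp x h

lemma cau_hasDeriv_p (a : ℂ) (x : ℝ) :
    HasDerivAt (fun x : ℝ => (1 + (x : ℂ) * Complex.I) ^ a)
      (a * (1 + (x : ℂ) * Complex.I) ^ (a - 1) * Complex.I) x := by
  have h : HasDerivAt (fun x : ℝ => 1 + (x : ℂ) * Complex.I) Complex.I x := by
    simpa using ((hasDerivAt_id x).ofReal_comp.mul_const Complex.I).const_add 1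
  exact cau_cpow_comp h (cau_slit_p x) a

lemma cau_hasDeriv_m (a : ℂ) (x : ℝ) :
    HasDerivAt (fun x : ℝ => (1 - (x : ℂ) * Complex.I) ^ a)
      (a * (1 - (x : ℂ) * Complex.I) ^ (a - 1) * (-Complex.I)) x := by
  have h : HasDerivAt (fun x : ℝ => 1 - (x : ℂ) * Complex.I) (-Complex.I) x := by
    simpa using ((hasDerivAt_id x).ofReal_comp.mul_const Complex.I).const_sub 1
  exact cau_cpow_comp h (cau_slit_m x) a

lemma cau_hasDeriv (a b : ℂ) (x : ℝ) :
    HasDerivAt (cauE a b)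
      (Complex.I * (b * cauE a (b + 1) x - a * cauE (a + 1) b x)) x := by
  refine ((cau_hasDeriv_p (-a) x).mul (cau_hasDeriv_m (-b) x)).congr_deriv ?_
  simp only [cauE]
  rw [show -(a + 1) = -a - 1 by ring, show -(b + 1) = -b - 1 by ring]
  ring

lemma cau_cont (a b : ℂ) : Continuous (cauE a b) :=
  continuous_iff_continuousAt.2 fun x => (cau_hasDeriv a b x).continuousAt

lemma cau_integrable {a b : ℂ} (h : 1 < (a + b).re) : Integrable (cauE a b) := by
  have := integrable_rpow_neg_one_add_norm_sq (E := ℝ) (μ := volume) (r := (a + b).re) (by simpa using h)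
  exact (this.const_mul _).mono' (cau_cont a b).aestronglyMeasurable
    (Eventually.of_forall fun x => cau_bound a b x)

lemma cau_tendsto {a b : ℂ} (h : 0 < (a + b).re) {l : Filter ℝ}
    (hl : Tendsto (fun x : ℝ => ‖x‖) l atTop) : Tendsto (cauE a b) l (𝓝 0) := by
  refine squeeze_zero_norm (cau_bound a b) ?_
  rw [← mul_zero (Real.exp (Real.pi * |a.im|) * Real.exp (Real.pi * |b.im|))]
  refine Tendsto.const_mul _ ?_
  have h1 : Tendsto (fun x : ℝ => 1 + ‖x‖ ^ 2) l atTop :=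
    tendsto_atTop_add_const_left _ _ ((tendsto_pow_atTop two_ne_zero).comp hl)
  have := (tendsto_rpow_neg_atTop (y := (a + b).re / 2) (by positivity)).comp h1
  simpa only [neg_div, Function.comp_def] using this

lemma cau_ibp {a b : ℂ} (h : 0 < (a + b).re) :
    b * ∫ x, cauE a (b + 1) x = a * ∫ x, cauE (a + 1) b x := by
  have i1 : Integrable (cauE a (b + 1)) := cau_integrable (by simp at h ⊢; linarith)
  have i2 : Integrable (cauE (a + 1) b) := cau_integrable (by simp at h ⊢; linarith)
  have := integral_of_hasDerivAt_of_tendsto (cau_hasDeriv a b)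
    (((i1.const_mul b).sub (i2.const_mul a)).const_mul Complex.I)
    (cau_tendsto h tendsto_abs_atBot_atTop) (cau_tendsto h tendsto_abs_atTop_atTop)
  rw [integral_const_mul, integral_sub (i1.const_mul b) (i2.const_mul a), integral_const_mul,
    integral_const_mul, sub_self] at this
  have := (mul_eq_zero.1 this).resolve_left I_ne_zero
  exact sub_eq_zero.1 this

lemma cau_two {a b : ℂ} (h : 1 < (a + b).re) :
    2 * ∫ x, cauE (a + 1) b x = (∫ x, cauE a b x) + ∫ x, cauE (a + 1) (b - 1) x := by
  have i1 : Integrable (cauE a b) := cau_integrable h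
  have i2 : Integrable (cauE (a + 1) (b - 1)) := cau_integrable (by simp at h ⊢; linarith)
  rw [← integral_add i1 i2, ← integral_const_mul]
  congr 1
  ext x
  simp only [cauE]
  have e1 : (1 + (x : ℂ) * Complex.I) ^ (-a) =
      (1 + (x : ℂ) * Complex.I) ^ (-(a + 1)) * (1 + (x : ℂ) * Complex.I) := by
    conv_lhs => rw [show -a = -(a + 1) + 1 by ring, cpow_add _ _ (cau_ne_p x), cpow_one]
  have e2 : (1 - (x : ℂ) * Complex.I) ^ (-(b - 1)) =
      (1 - (x : ℂ) * Complex.I) ^ (-b) * (1 - (x : ℂ) * Complex.I) := by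
    rw [show -(b - 1) = -b + 1 by ring, cpow_add _ _ (cau_ne_m x), cpow_one]
  rw [e1, e2]; ring

lemma cau_rec {a b : ℂ} (h : 1 < (a + b).re) :
    (a + b - 1) * ∫ x, cauE a b x = 2 * a * ∫ x, cauE (a + 1) b x := by
  have h1 := cau_ibp (a := a) (b := b - 1) (by simp at h ⊢; linarith)
  rw [sub_add_cancel] at h1
  linear_combination -a * cau_two h + h1

lemma cau_symm (a b : ℂ) : ∫ x, cauE a b x = ∫ x, cauE b a x := by
  rw [← integral_neg_eq_self (cauE b a)]
  congr 1; ext x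
  simp [cauE, mul_comm, sub_eq_add_neg]

/-- right side -/
noncomputable def cauR (α β : ℂ) : ℂ := (2 : ℂ) ^ (2 - α - β) * (Real.pi : ℂ) *
          (Complex.Gamma (α + β - 1) / (Complex.Gamma α * Complex.Gamma β))

lemma cauR_symm (a b : ℂ) : cauR a b = cauR b a := by
  unfold cauR
  rw [mul_comm (Gamma a), add_comm a b, show 2 - a - b = 2 - b - a by ring]

lemma cau_step {a b : ℂ} (h : 1 < (a + b).re)
    (hs : ∫ x, cauE (a + 1) b x = cauR (a + 1) b) : ∫ x, cauE a b x = cauR a b := by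
  have hne : a + b - 1 ≠ 0 := by
    intro h0
    have := congrArg re h0
    simp at this h
    linarith
  apply mul_left_cancel₀ hne
  rw [cau_rec h, hs]
  unfold cauR
  by_cases ha : a = 0
  · subst ha; simp
  rw [show a + 1 + b - 1 = (a + b - 1) + 1 by ring, Gamma_add_one _ hne, Gamma_add_one _ ha,
    show (2 : ℂ) - a - b = (2 - (a + 1) - b) + 1 by ring, cpow_add _ _ two_ne_zero, cpow_one,
    mul_assoc a, div_mul_eq_div_div]
  rw [mul_div_assoc, mul_div_assoc]
  field_simp

lemma cau_down (b : ℂ) (hb : ∀ a : ℂ, 1 < a.re → 1 < (a + b).re → ∫ x, cauE a b x = cauR a b)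
    (n : ℕ) : ∀ a : ℂ, 1 < a.re + n → 1 < (a + b).re → ∫ x, cauE a b x = cauR a b := by
  induction n with
  | zero => intro a h1 h2; exact hb a (by simpa using h1) h2
  | succ n ih =>
    intro a h1 h2
    refine cau_step h2 (ih _ ?_ ?_)
    · push_cast at h1; simp; linarith
    · simp at h2 ⊢; linarith

/-- Gamma density -/
noncomputable def cauf (a : ℂ) (t : ℝ) : ℂ := ((max t 0 : ℝ) : ℂ) ^ (a - 1) * Real.exp (-t)

lemma cauf_cont {a : ℂ} (ha : 1 < a.re) : Continuous (cauf a) := by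
  unfold cauf
  have := continuous_ofReal_cpow_const (y := a - 1) (by simpa using ha)
  have := this.comp (continuous_id.max continuous_const : Continuous fun t : ℝ => max t 0)
  exact this.mul (by fun_prop)

lemma cauf_neg {a : ℂ} (ha : 1 < a.re) {t : ℝ} (ht : t ≤ 0) : cauf a t = 0 := by
  have : a - 1 ≠ 0 := by
    intro h0
    have := congrArg re h0
    simp at this
    linarith
  simp [cauf, max_eq_right ht, this]

lemma cauf_pos (a : ℂ) {t : ℝ} (ht : 0 < t) : cauf a t = (t : ℂ) ^ (a - 1) * Real.exp (-t) := by
  simp [cauf, max_eq_left ht.le]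

lemma cauf_setIntegral {a : ℂ} (ha : 1 < a.re) (g : ℝ → ℂ) :
    ∫ t, g t * cauf a t = ∫ t in Ioi 0, g t * cauf a t := by
  refine (setIntegral_eq_integral_of_forall_compl_eq_zero fun t ht => ?_).symm
  rw [cauf_neg ha (by simpa using ht), mul_zero]

lemma cauf_integrable {a : ℂ} (ha : 1 < a.re) : Integrable (cauf a) := by
  have h1 : IntegrableOn (cauf a) (Ioi 0) := by
    refine (GammaIntegral_convergent (s := a) (by linarith)).congr_fun (fun t ht => ?_)
      measurableSet_Ioi
    simp only [cauf_pos a ht, mul_comm]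
  rwa [integrableOn_iff_integrable_of_support_subset] at h1
  intro t ht
  by_contra h
  exact ht (cauf_neg ha (by simpa using h))

lemma cauf_integral {a : ℂ} (ha : 1 < a.re) : ∫ t, cauf a t = Gamma a := by
  rw [Gamma_eq_integral (by linarith), GammaIntegral]
  have := cauf_setIntegral ha (fun _ => 1)
  simp only [one_mul] at this
  rw [this]
  refine setIntegral_congr_fun measurableSet_Ioi fun t ht => ?_
  simp only [cauf_pos a ht, mul_comm]

lemma cauf_succ {a : ℂ} (ha : 1 < a.re) (t : ℝ) : cauf (a + 1) t = t * cauf a t := by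
  rcases le_or_gt t 0 with h | h
  · rw [cauf_neg ha h, cauf_neg (by simp; linarith) h, mul_zero]
  · rw [cauf_pos _ h, cauf_pos _ h, show a + 1 - 1 = (a - 1) + 1 by ring,
      cpow_add _ _ (by exact_mod_cast h.ne'), cpow_one]
    ring

lemma cauF_eq (a : ℂ) (w : ℝ) :
    𝓕 (cauf a) w = ∫ t : ℝ, Complex.exp (-(2 * Real.pi * Complex.I * w) * t) * cauf a t := by
  rw [Real.fourier_real_eq_integral_exp_smul]
  congr 1; ext t
  rw [smul_eq_mul]
  congr 2
  push_cast; ring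

lemma cau_exp_integrable {a : ℂ} (ha : 1 < a.re) (w : ℝ) :
    Integrable fun t : ℝ => Complex.exp (-(2 * Real.pi * Complex.I * w) * t) * cauf a t := by
  refine (cauf_integrable ha).bdd_mul (c := 1) (by fun_prop) (Eventually.of_forall fun t => ?_)
  rw [norm_exp]; simp

lemma cauF_ibp {a : ℂ} (ha : 1 < a.re) (w : ℝ) :
    a * 𝓕 (cauf a) w = (1 + (2 * Real.pi * w : ℝ) * Complex.I) * 𝓕 (cauf (a + 1)) w := by
  have ha' : 1 < (a + 1).re := by simp; linarith
  rw [cauF_eq, cauF_eq]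
  set c : ℂ := -(2 * Real.pi * Complex.I * w) with hc
  have i1 := cau_exp_integrable ha w
  have i2 := cau_exp_integrable ha' w
  rw [← hc] at i1 i2
  have hd : ∀ t ∈ Ioi (0 : ℝ), HasDerivAt (fun t : ℝ => Complex.exp (c * t) * cauf (a + 1) t)
      (a * (Complex.exp (c * t) * cauf a t) - (1 - c) * (Complex.exp (c * t) * cauf (a + 1) t)) t := by
    intro t ht
    have h1 : HasDerivAt (fun t : ℝ => Complex.exp (c * t)) (Complex.exp (c * t) * c) t := by
      simpa using (((hasDerivAt_id t).ofReal_comp.const_mul c)).cexp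
    have h2 : HasDerivAt (fun t : ℝ => (t : ℂ) ^ a) (a * (t : ℂ) ^ (a - 1)) t := by
      simpa using cau_cpow_comp (hasDerivAt_id t).ofReal_comp (by left; simpa using ht) a
    have h3 : HasDerivAt (fun t : ℝ => ((Real.exp (-t) : ℝ) : ℂ)) (-(Real.exp (-t) : ℝ) : ℂ) t := by
      simpa using ((hasDerivAt_id t).neg.exp).ofReal_comp
    have h4 := h1.mul (h2.mul h3)
    refine (h4.congr_of_eventuallyEq ?_).congr_deriv ?_
    · filter_upwards [Ioi_mem_nhds ht] with s hs
      simp [cauf_pos _ hs]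
    · rw [cauf_pos _ ht, cauf_pos _ ht]
      simp only [add_sub_cancel_right, Pi.mul_apply]
      ring
  have i3 := (i1.const_mul a).sub (i2.const_mul (1 - c))
  have ht := tendsto_zero_of_hasDerivAt_of_integrableOn_Ioi hd i3.integrableOn i2.integrableOn
  have hcont : Continuous (fun t : ℝ => Complex.exp (c * t) * cauf (a + 1) t) :=
    (by fun_prop : Continuous fun t : ℝ => Complex.exp (c * t)).mul (cauf_cont ha')
  have := integral_Ioi_of_hasDerivAt_of_tendsto hcont.continuousWithinAt hd i3.integrableOn ht
  rw [integral_sub (i1.const_mul a).integrableOn (i2.const_mul _).integrableOn, integral_const_mul,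
    integral_const_mul, ← cauf_setIntegral ha, ← cauf_setIntegral ha', cauf_neg ha' le_rfl,
    mul_zero, sub_zero] at this
  rw [sub_eq_zero.1 this, hc]
  push_cast
  ring

lemma cauF_val {a : ℂ} (ha : 1 < a.re) (w : ℝ) :
    𝓕 (cauf a) w = Gamma a * (1 + ((2 * Real.pi * w : ℝ) : ℂ) * Complex.I) ^ (-a) := by
  have ha' : 1 < (a + 1).re := by simp; linarith
  have hd : ∀ w : ℝ, HasDerivAt (𝓕 (cauf a)) (-2 * Real.pi * Complex.I * 𝓕 (cauf (a + 1)) w) w := by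
    intro w
    have hi : Integrable (fun x : ℝ => x • cauf a x) := by
      refine (cauf_integrable ha').congr (Eventually.of_forall fun t => ?_)
      simp [cauf_succ ha]
    refine (Real.hasDerivAt_fourier (cauf_integrable ha) hi w).congr_deriv ?_
    rw [Real.fourier_real_eq_integral_exp_smul, Real.fourier_real_eq_integral_exp_smul,
      ← integral_const_mul]
    congr 1; ext t
    simp only [smul_eq_mul, cauf_succ ha]
    ring
  have hg : ∀ w : ℝ, HasDerivAt (fun w : ℝ =>
      (1 + ((2 * Real.pi * w : ℝ) : ℂ) * Complex.I) ^ a * 𝓕 (cauf a) w) 0 w := by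
    intro w
    have h1 : HasDerivAt (fun w : ℝ => 2 * Real.pi * w) (2 * Real.pi) w := by
      simpa using (hasDerivAt_id w).const_mul (2 * Real.pi)
    have h2 := (cau_hasDeriv_p a (2 * Real.pi * w)).scomp w h1
    refine (h2.mul (hd w)).congr_deriv ?_
    have e := cauF_ibp ha w
    have e1 : (1 + ((2 * Real.pi * w : ℝ) : ℂ) * Complex.I) ^ a =
      (1 + ((2 * Real.pi * w : ℝ) : ℂ) * Complex.I) ^ (a - 1) *
        (1 + ((2 * Real.pi * w : ℝ) : ℂ) * Complex.I) := by
      conv_lhs => rw [show a = (a - 1) + 1 by ring, cpow_add _ _ (cau_ne_p _), cpow_one]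
    simp only [Function.comp_apply, e1, real_smul]
    push_cast at e ⊢
    linear_combination (2 * Real.pi * Complex.I *
      (1 + (2 * Real.pi * w : ℂ) * Complex.I) ^ (a - 1)) * e
  have hconst := is_const_of_deriv_eq_zero (fun w => (hg w).differentiableAt)
    (fun w => (hg w).deriv) w 0
  have h0 : 𝓕 (cauf a) 0 = Gamma a := by
    rw [cauF_eq, ← cauf_integral ha]; simp
  simp only [h0, mul_zero, ofReal_zero, zero_mul, add_zero, one_cpow, one_mul] at hconst
  rw [← hconst, cpow_neg]
  have : (1 + ((2 * Real.pi * w : ℝ) : ℂ) * Complex.I) ^ a ≠ 0 := by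
    exact fun h => cau_ne_p _ ((cpow_eq_zero_iff _ _).1 h).1
  field_simp

lemma cauFinv_val {a : ℂ} (ha : 1 < a.re) (w : ℝ) :
    𝓕⁻ (cauf a) w = Gamma a * (1 - ((2 * Real.pi * w : ℝ) : ℂ) * Complex.I) ^ (-a) := by
  rw [Real.fourierInv_eq_fourier_neg, cauF_val ha]
  simp [sub_eq_add_neg]

lemma cau_two_pi_ne : (2 * Real.pi) ≠ 0 := by positivity

lemma cau_base {a b : ℂ} (ha : 1 < a.re) (hb : 1 < b.re) : ∫ x, cauE a b x = cauR a b := by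
  have hF : Integrable (𝓕 (cauf b)) := by
    have h1 : Integrable (cauE b 0) := cau_integrable (by simpa using hb)
    refine ((h1.comp_mul_left' cau_two_pi_ne).const_mul (Gamma b)).congr
      (Eventually.of_forall fun w => ?_)
    simp [cauF_val hb, cauE]
  have hFi : Integrable (𝓕⁻ (cauf b)) := by
    have h1 : Integrable (cauE 0 b) := cau_integrable (by simpa using hb)
    refine ((h1.comp_mul_left' cau_two_pi_ne).const_mul (Gamma b)).congr
      (Eventually.of_forall fun w => ?_)
    simp [cauFinv_val hb, cauE]
  have key : ∫ w, 𝓕 (cauf a) w * 𝓕⁻ (cauf b) w = ∫ t, cauf a t * cauf b t := by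
    have h := VectorFourier.integral_fourierIntegral_smul_eq_flip (L := innerₗ ℝ)
      Real.continuous_fourierChar continuous_inner (cauf_integrable ha) hFi
    have h2 := (cauf_cont hb).fourier_fourierInv_eq (cauf_integrable hb) hF
    rw [flip_innerₗ] at h
    change ∫ w, 𝓕 (cauf a) w * 𝓕⁻ (cauf b) w = ∫ t, cauf a t * 𝓕 (𝓕⁻ (cauf b)) t at h
    rw [h, h2]
  have hr : ∫ t, cauf a t * cauf b t = (1 / 2 : ℂ) ^ (a + b - 1) * Gamma (a + b - 1) := by
    have := integral_cpow_mul_exp_neg_mul_Ioi (a := a + b - 1) (r := 2) (by simp; linarith) two_pos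
    rw [cauf_setIntegral hb]
    push_cast at this
    rw [← this]
    refine setIntegral_congr_fun measurableSet_Ioi fun t ht => ?_
    simp only [cauf_pos _ ht]
    rw [show a + b - 1 - 1 = (a - 1) + (b - 1) by ring,
      cpow_add _ _ (by exact_mod_cast (ne_of_gt ht)), show -(2 * (t : ℂ)) = -t + -t by ring,
      Complex.exp_add]
    push_cast
    ring
  have hl : ∫ w, 𝓕 (cauf a) w * 𝓕⁻ (cauf b) w =
      Gamma a * Gamma b * (((2 * Real.pi)⁻¹ : ℝ) * ∫ x, cauE a b x) := by
    have h := Measure.integral_comp_mul_left (cauE a b) (2 * Real.pi)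
    rw [abs_of_pos (by positivity), real_smul] at h
    rw [← h, ← integral_const_mul]
    congr 1; ext w
    rw [cauF_val ha, cauFinv_val hb, cauE]
    ring
  rw [hl, hr] at key
  have ga := Gamma_ne_zero_of_re_pos (s := a) (by linarith)
  have gb := Gamma_ne_zero_of_re_pos (s := b) (by linarith)
  have hpi : (Real.pi : ℂ) ≠ 0 := by exact_mod_cast Real.pi_ne_zero
  have e : (2 : ℂ) ^ (2 - a - b) = 2 * (1 / 2 : ℂ) ^ (a + b - 1) := by
    rw [one_div, inv_cpow _ _ (by rw [show (2 : ℂ) = ((2 : ℝ) : ℂ) by norm_num, arg_ofReal_of_nonneg zero_le_two]; exact Real.pi_pos.ne), ← cpow_neg,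
      show 2 - a - b = 1 + -(a + b - 1) by ring, cpow_add _ _ two_ne_zero, cpow_one]
  rw [cauR, e]
  push_cast at key
  field_simp at key ⊢
  linear_combination key

/-- For `Re(α+β) > 1`,
`∫_ℝ dx/((1+ix)^α (1-ix)^β) = 2^{2-α-β} π Γ(α+β-1)/(Γ(α)Γ(β))`. -/
theorem stmt5 (α β : ℂ) (h : 1 < (α + β).re) :
    ∫ x : ℝ, 1 / ((1 + (x : ℂ) * Complex.I) ^ α * (1 - (x : ℂ) * Complex.I) ^ β)
      = (2 : ℂ) ^ (2 - α - β) * (Real.pi : ℂ) *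
          (Complex.Gamma (α + β - 1) / (Complex.Gamma α * Complex.Gamma β)) := by
  have h1 : ∀ a b : ℂ, 1 < a.re → 1 < (a + b).re → ∫ x, cauE a b x = cauR a b := by
    intro a b ha hab
    rw [cau_symm, cauR_symm]
    obtain ⟨n, hn⟩ := exists_nat_gt (1 - b.re)
    refine cau_down a (fun b hb _ => cau_base hb ha) n b (by linarith) (by rwa [add_comm])
  obtain ⟨n, hn⟩ := exists_nat_gt (1 - α.re)
  have := cau_down β (fun a ha hab => h1 a β ha hab) n α (by linarith) h
  rw [cauR] at this
  rw [← this]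
  congr 1; ext x
  rw [cauE, cpow_neg, cpow_neg, one_div, mul_inv]
end
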